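/- (Lower bound on the minorization constant.) Let Q be an n × n real matrix with nonnegative entries and let 0 < q ≤ 1 be such that every nonzero entry of Q is at least q. Let I be a nonempty subset of {1, …, n} and let N ≥ 1 be an integer such that for every index i and every j ∈ I there exists 1 ≤ m ≤ N with (Q^m)_{ij} > 0. Then min over i of (1/N) · Σ_{m=1}^{N} Σ_{j ∈ I} (Q^m)_{ij} ≥ (|I| / N) · q^N. -/

import Mathlib

open Finset

namespace Matrix

variable {ι R : Type*} [Fintype ι] [DecidableEq ι] [Semiring R] [PartialOrder R] [IsOrderedRing R]

/-- If every nonzero entry of a nonnegative matrix is at least `q`, then every nonzero entry of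
its `m`-th power is at least `q ^ m`. -/
lemma pow_le_pow_apply {Q : Matrix ι ι R} {q : R} (hq : 0 ≤ q) (hQ : ∀ i j, 0 ≤ Q i j)
    (hlb : ∀ i j, Q i j ≠ 0 → q ≤ Q i j) {m : ℕ} {i j : ι} (h : (Q ^ m) i j ≠ 0) :
    q ^ m ≤ (Q ^ m) i j := by
  induction m generalizing j with
  | zero =>
    rw [pow_zero Q, one_apply] at h ⊢
    split_ifs at h ⊢ <;> simp_all
  | succ m ih =>
    rw [pow_succ Q, mul_apply] at h ⊢
    obtain ⟨k, -, hk⟩ := exists_ne_zero_of_sum_ne_zero h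
    calc q ^ (m + 1) = q ^ m * q := pow_succ q m
      _ ≤ (Q ^ m) i k * Q k j :=
        mul_le_mul (ih (left_ne_zero_of_mul hk)) (hlb k j (right_ne_zero_of_mul hk)) hq
          (pow_apply_nonneg hQ m i k)
      _ ≤ ∑ l, (Q ^ m) i l * Q l j :=
        single_le_sum (f := fun l => (Q ^ m) i l * Q l j)
          (fun l _ => mul_nonneg (pow_apply_nonneg hQ m i l) (hQ l j)) (mem_univ k)

end Matrix

/-- **Lower bound on the minorization constant.** Let `Q` be an `n × n`
nonnegative matrix whose nonzero entries are all at least `q ∈ (0,1]`, `I` a nonempty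
subset of indices and `N ≥ 1` such that every `j ∈ I` can be reached from any `i` in at
most `N` steps.  Then
`min_i (1/N) · Σ_{m=1}^{N} Σ_{j ∈ I} (Q^m)_{ij} ≥ (|I|/N) · q^N`. -/
theorem minorization_lower_bound
    (n N : ℕ) (Q : Matrix (Fin n) (Fin n) ℝ) (q : ℝ)
    (hq0 : 0 < q) (hq1 : q ≤ 1)
    (hnonneg : ∀ i j, 0 ≤ Q i j)
    (hlb : ∀ i j, Q i j ≠ 0 → q ≤ Q i j)
    (I : Finset (Fin n)) (hI : I.Nonempty)
    (hN : 1 ≤ N)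
    (hreach : ∀ i : Fin n, ∀ j ∈ I, ∃ m : ℕ, 1 ≤ m ∧ m ≤ N ∧ 0 < (Q ^ m) i j) :
    ∀ i : Fin n,
      ((I.card : ℝ) / N) * q ^ N ≤
        (1 / N : ℝ) * ∑ m ∈ Finset.Icc 1 N, ∑ j ∈ I, (Q ^ m) i j := by
  intro i
  have key : (I.card : ℝ) * q ^ N ≤ ∑ m ∈ Finset.Icc 1 N, ∑ j ∈ I, (Q ^ m) i j := by
    rw [sum_comm, ← nsmul_eq_mul]
    refine card_nsmul_le_sum _ _ _ fun j hj => ?_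
    obtain ⟨m, hm1, hmN, hm⟩ := hreach i j hj
    calc q ^ N ≤ q ^ m := pow_le_pow_of_le_one hq0.le hq1 hmN
      _ ≤ (Q ^ m) i j := Matrix.pow_le_pow_apply hq0.le hnonneg hlb hm.ne'
      _ ≤ ∑ m ∈ Finset.Icc 1 N, (Q ^ m) i j :=
        single_le_sum (f := fun m => (Q ^ m) i j)
          (fun m _ => Matrix.pow_apply_nonneg hnonneg m i j) (mem_Icc.2 ⟨hm1, hmN⟩)
  calc ((I.card : ℝ) / N) * q ^ N = (1 / N : ℝ) * (I.card * q ^ N) := by ring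
    _ ≤ _ := mul_le_mul_of_nonneg_left key (by positivity)
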